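/- There exist universal constants c, c', ε₀ > 0 such that for every ε ∈ (0, ε₀) there exists a model class M ⊆ M⁺ (over a suitable decision and observation space) satisfying sup_{M̄∈co(M)} dec^c_ε(M, M̄) ≤ c·ε, yet sup_{M̄∈co(M)} dec^c_ε(M ∪ {M̄}, M̄) ≥ c'·ε^{2/3}. -/

import Mathlib

open MeasureTheory ProbabilityTheory
open scoped ENNReal NNReal

noncomputable section

/-- The squared Hellinger distance between two measures, computed with respect to the
common dominating measure `P + Q`. -/
def sqHellinger {Z : Type} [MeasurableSpace Z] (P Q : Measure Z) : ℝ :=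
  ∫ z, (Real.sqrt ((P.rnDeriv (P + Q)) z).toReal
      - Real.sqrt ((Q.rnDeriv (P + Q)) z).toReal) ^ 2 ∂(P + Q)

/-- A model: a Markov kernel from decisions to distributions over reward/observation pairs,
with rewards supported in `[0,1]`, together with a maximizing decision
(whose existence is assumed). -/
structure Model (X Y : Type) [MeasurableSpace X] [MeasurableSpace Y] where
  k : Kernel X (ℝ × Y)
  markov : IsMarkovKernel k
  reward01 : ∀ x : X, (k x) {ry : ℝ × Y | ry.1 ∈ Set.Icc (0 : ℝ) 1}ᶜ = 0
  opt : X
  opt_max : ∀ x : X, (∫ ry, ry.1 ∂(k x)) ≤ ∫ ry, ry.1 ∂(k opt)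

variable {X Y : Type} [MeasurableSpace X] [MeasurableSpace Y]

/-- Mean reward `f^M(x)`. -/
def fm (M : Model X Y) (x : X) : ℝ := ∫ ry, ry.1 ∂(M.k x)

/-- Suboptimality gap `g^M(x) = f^M(π_M) - f^M(x)`. -/
def gap (M : Model X Y) (x : X) : ℝ := fm M M.opt - fm M x

/-- Expected suboptimality of a decision distribution `p` under model `M`. -/
def avgGap (p : ProbabilityMeasure X) (M : Model X Y) : ℝ :=
  ∫ x, gap M x ∂(p : Measure X)

/-- Expected squared Hellinger distance between `M` and `Mbar` under `p`. -/
def avgHell (p : ProbabilityMeasure X) (M Mbar : Model X Y) : ℝ :=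
  ∫ x, sqHellinger (M.k x) (Mbar.k x) ∂(p : Measure X)

/-- The constrained regret Decision-Estimation Coefficient. -/
def decC (ε : ℝ) (𝓜 : Set (Model X Y)) (Mbar : Model X Y) : ℝ :=
  ⨅ p : ProbabilityMeasure X,
    ⨆ M ∈ {M ∈ 𝓜 | avgHell p M Mbar ≤ ε ^ 2}, avgGap p M

/-- The offset regret Decision-Estimation Coefficient. -/
def decO (γ : ℝ) (𝓜 : Set (Model X Y)) (Mbar : Model X Y) : ℝ :=
  ⨅ p : ProbabilityMeasure X, ⨆ M ∈ 𝓜, (avgGap p M - γ * avgHell p M Mbar)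

/-- The constrained PAC Decision-Estimation Coefficient. -/
def decCpac (ε : ℝ) (𝓜 : Set (Model X Y)) (Mbar : Model X Y) : ℝ :=
  ⨅ p : ProbabilityMeasure X, ⨅ q : ProbabilityMeasure X,
    ⨆ M ∈ {M ∈ 𝓜 | avgHell q M Mbar ≤ ε ^ 2}, avgGap p M

/-- The offset PAC Decision-Estimation Coefficient. -/
def decOpac (γ : ℝ) (𝓜 : Set (Model X Y)) (Mbar : Model X Y) : ℝ :=
  ⨅ p : ProbabilityMeasure X, ⨅ q : ProbabilityMeasure X,
    ⨆ M ∈ 𝓜, (avgGap p M - γ * avgHell q M Mbar)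

/-- A distribution over a class of models, represented as a probability space together with
a (measurable) family of models belonging to the class. -/
structure ClassDist (X Y : Type) [MeasurableSpace X] [MeasurableSpace Y]
    (𝓜 : Set (Model X Y)) where
  (Ω : Type)
  [iΩ : MeasurableSpace Ω]
  (ν : Measure Ω)
  (prob : IsProbabilityMeasure ν)
  (m : Ω → Model X Y)
  (mem : ∀ ω, m ω ∈ 𝓜)
  (meas : ∀ (x : X) (A : Set (ℝ × Y)), MeasurableSet A → Measurable fun ω => (m ω).k x A)

attribute [instance] ClassDist.iΩ

/-- `Mbar` is the mixture (mean) model of the class distribution `D`. -/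
def IsMixtureOf {𝓜 : Set (Model X Y)} (D : ClassDist X Y 𝓜) (Mbar : Model X Y) : Prop :=
  ∀ (x : X) (A : Set (ℝ × Y)), MeasurableSet A →
    Mbar.k x A = ∫⁻ ω, (D.m ω).k x A ∂D.ν

/-- The convex hull of a model class: all mixtures of models in the class. -/
def convHull (𝓜 : Set (Model X Y)) : Set (Model X Y) :=
  {Mbar | ∃ D : ClassDist X Y 𝓜, IsMixtureOf D Mbar}

/-- `dec^c_ε(𝓜) = sup_{Mbar ∈ co(𝓜)} dec^c_ε(𝓜 ∪ {Mbar}, Mbar)`. -/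
def decCfull (ε : ℝ) (𝓜 : Set (Model X Y)) : ℝ :=
  ⨆ Mbar ∈ convHull 𝓜, decC ε (𝓜 ∪ {Mbar}) Mbar

/-- `dec^{c,pac}_ε(𝓜) = sup_{Mbar ∈ co(𝓜)} dec^{c,pac}_ε(𝓜, Mbar)`. -/
def decCpacFull (ε : ℝ) (𝓜 : Set (Model X Y)) : ℝ :=
  ⨆ Mbar ∈ convHull 𝓜, decCpac ε 𝓜 Mbar

/-- The localized subclass `𝓜_α(Mbar)`. -/
def locClass (α : ℝ) (𝓜 : Set (Model X Y)) (Mbar : Model X Y) : Set (Model X Y) :=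
  {M ∈ 𝓜 | fm M M.opt ≤ fm Mbar Mbar.opt + α}

/-- The greedy PAC Decision-Estimation Coefficient. -/
def decGpac (ε : ℝ) (𝓜 : Set (Model X Y)) (Mbar : Model X Y) : ℝ :=
  ⨅ q : ProbabilityMeasure X,
    ⨆ M ∈ {M ∈ 𝓜 | avgHell q M Mbar ≤ ε ^ 2}, (fm M M.opt - fm M Mbar.opt)

/-- The PAC DEC with Hellinger constraints under both `p` and `q`. -/
def decAlt (ε : ℝ) (𝓜 : Set (Model X Y)) (Mbar : Model X Y) : ℝ :=
  ⨅ p : ProbabilityMeasure X, ⨅ q : ProbabilityMeasure X,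
    ⨆ M ∈ {M ∈ 𝓜 | avgHell p M Mbar ≤ ε ^ 2 ∧ avgHell q M Mbar ≤ ε ^ 2}, avgGap p M

/-- Expected squared Hellinger distance to a randomized reference model. -/
def randAvgHell {𝓜 : Set (Model X Y)} (p : ProbabilityMeasure X) (M : Model X Y)
    (D : ClassDist X Y 𝓜) : ℝ :=
  ∫ ω, avgHell p M (D.m ω) ∂D.ν

/-- The randomized offset regret DEC. -/
def decOrand (γ : ℝ) {𝓜₀ : Set (Model X Y)} (𝓜 : Set (Model X Y))
    (D : ClassDist X Y 𝓜₀) : ℝ :=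
  ⨅ p : ProbabilityMeasure X, ⨆ M ∈ 𝓜, (avgGap p M - γ * randAvgHell p M D)

/-- The randomized constrained regret DEC. -/
def decCrand (ε : ℝ) {𝓜₀ : Set (Model X Y)} (𝓜 : Set (Model X Y))
    (D : ClassDist X Y 𝓜₀) : ℝ :=
  ⨅ p : ProbabilityMeasure X,
    ⨆ M ∈ {M ∈ 𝓜 | randAvgHell p M D ≤ ε ^ 2}, avgGap p M

/-- The randomized offset PAC DEC. -/
def decOpacRand (γ : ℝ) {𝓜₀ : Set (Model X Y)} (𝓜 : Set (Model X Y))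
    (D : ClassDist X Y 𝓜₀) : ℝ :=
  ⨅ p : ProbabilityMeasure X, ⨅ q : ProbabilityMeasure X,
    ⨆ M ∈ 𝓜, (avgGap p M - γ * randAvgHell q M D)

/-- The Bayesian offset regret DEC (sup over priors of the inf over decision distributions). -/
def bayesDecO (γ : ℝ) (𝓜 : Set (Model X Y)) (Mbar : Model X Y) : ℝ :=
  sSup {x : ℝ | ∃ D : ClassDist X Y 𝓜,
    x = ⨅ p : ProbabilityMeasure X,
          ∫ ω, (avgGap p (D.m ω) - γ * avgHell p (D.m ω) Mbar) ∂D.ν}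

/-- The Bayesian offset PAC DEC. -/
def bayesDecOpac (γ : ℝ) (𝓜 : Set (Model X Y)) (Mbar : Model X Y) : ℝ :=
  sSup {x : ℝ | ∃ D : ClassDist X Y 𝓜,
    x = ⨅ p : ProbabilityMeasure X, ⨅ q : ProbabilityMeasure X,
          ∫ ω, (avgGap p (D.m ω) - γ * avgHell q (D.m ω) Mbar) ∂D.ν}

/-- Histories of interaction. -/
abbrev Hist (X Y : Type) (n : ℕ) := Fin n → X × ℝ × Y

/-- Prefix of a history. -/
def hPrefix {n : ℕ} (h : Hist X Y n) (t : ℕ) (ht : t ≤ n) : Hist X Y t :=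
  fun i => h (Fin.castLE ht i)

/-- Law of the interaction history under model `M` and selection rule `sel`. -/
def histLaw (M : Model X Y) (sel : (n : ℕ) → Hist X Y n → Measure X) :
    (n : ℕ) → Measure (Hist X Y n)
  | 0 => Measure.dirac (fun i => i.elim0)
  | n + 1 =>
    (histLaw M sel n).bind fun h =>
      (sel n h).bind fun x =>
        (M.k x).bind fun ry => Measure.dirac (Fin.snoc h (x, ry))

/-- A regret-minimization algorithm: a sequence of probability kernels from histories
to decisions. -/
structure RegAlg (X Y : Type) [MeasurableSpace X] [MeasurableSpace Y] where
  sel : (n : ℕ) → Hist X Y n → Measure X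
  prob : ∀ n h, IsProbabilityMeasure (sel n h)
  meas : ∀ n, Measurable (sel n)

instance [Nonempty X] : Nonempty (RegAlg X Y) :=
  ⟨⟨fun _ _ => Measure.dirac (Classical.arbitrary X),
    fun _ _ => by infer_instance, fun _ => measurable_const⟩⟩

/-- Expected cumulative regret of algorithm `A` under model `M` over `T` rounds. -/
def expRegret (M : Model X Y) (A : RegAlg X Y) (T : ℕ) : ℝ :=
  ∑ t ∈ Finset.range T, ∫ h, (∫ x, gap M x ∂(A.sel t h)) ∂(histLaw M A.sel t)

/-- A PAC algorithm with `T` rounds of interaction: exploration kernels together with an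
output kernel. -/
structure PacAlg (X Y : Type) [MeasurableSpace X] [MeasurableSpace Y] (T : ℕ) where
  explore : (n : ℕ) → Hist X Y n → Measure X
  explore_prob : ∀ n h, IsProbabilityMeasure (explore n h)
  explore_meas : ∀ n, Measurable (explore n)
  out : Hist X Y T → Measure X
  out_prob : ∀ h, IsProbabilityMeasure (out h)
  out_meas : Measurable out

/-- Risk of the PAC algorithm conditionally on the realized history. -/
def condRisk (M : Model X Y) {T : ℕ} (A : PacAlg X Y T) (h : Hist X Y T) : ℝ :=
  ∫ x, gap M x ∂(A.out h)

/-- Expected risk of PAC algorithm `A` under model `M`. -/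
def pacRisk (M : Model X Y) {T : ℕ} (A : PacAlg X Y T) : ℝ :=
  ∫ h, condRisk M A h ∂(histLaw M A.explore T)

/-- The density-ratio bound `V(𝓜)`. -/
def Vval (𝓜 : Set (Model X Y)) : ℝ≥0∞ :=
  max (ENNReal.ofReal (Real.exp 1))
    (⨆ M ∈ 𝓜, ⨆ M' ∈ 𝓜, ⨆ x : X,
      ⨆ A ∈ {A : Set (ℝ × Y) | MeasurableSet A}, M.k x A / M'.k x A)

/-- `C(T) = log (min (T, V(𝓜)))`. -/
def Cval (𝓜 : Set (Model X Y)) (T : ℕ) : ℝ :=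
  Real.log ((min (T : ℝ≥0∞) (Vval 𝓜)).toReal)

/-- An online estimation oracle for the class `𝓜` with estimation-error bound `Est`. -/
structure EstOracle (X Y : Type) [MeasurableSpace X] [MeasurableSpace Y]
    (𝓜 : Set (Model X Y)) (Est : ℝ → ℝ → ℝ) where
  est : (T' : ℕ) → (δ' : ℝ) → (n : ℕ) → Hist X Y n → Model X Y
  est_mem : ∀ T' δ' n h, est T' δ' n h ∈ convHull 𝓜
  guarantee : ∀ (T' : ℕ) (δ' : ℝ), 0 < δ' → ∀ Mstar ∈ 𝓜, ∀ A : RegAlg X Y,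
    ((histLaw Mstar A.sel T')
      {h : Hist X Y T' |
        (∑ t : Fin T',
          ∫ x, sqHellinger (Mstar.k x)
              ((est T' δ' (t : ℕ) (hPrefix h (t : ℕ) t.2.le)).k x)
            ∂(A.sel (t : ℕ) (hPrefix h (t : ℕ) t.2.le)))
          ≤ Est (T' : ℝ) δ'}).toReal ≥ 1 - δ'

/-- A constrained online estimation oracle for the class `𝓜`. -/
structure CEstOracle (X Y : Type) [MeasurableSpace X] [MeasurableSpace Y]
    (𝓜 : Set (Model X Y)) (Est : ℝ → ℝ → ℝ) where
  est : (𝓜' : Set (Model X Y)) → (T' : ℕ) → (δ' : ℝ) → (n : ℕ) → Hist X Y n → Model X Y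
  est_mem : ∀ 𝓜', 𝓜' ⊆ 𝓜 → ∀ T' δ' n h, est 𝓜' T' δ' n h ∈ convHull 𝓜'
  guarantee : ∀ 𝓜', 𝓜' ⊆ 𝓜 → ∀ (T' : ℕ) (δ' : ℝ), 0 < δ' → ∀ Mstar ∈ 𝓜',
    ∀ A : RegAlg X Y,
    ((histLaw Mstar A.sel T')
      {h : Hist X Y T' |
        (∑ t : Fin T',
          ∫ x, sqHellinger (Mstar.k x)
              ((est 𝓜' T' δ' (t : ℕ) (hPrefix h (t : ℕ) t.2.le)).k x)
            ∂(A.sel (t : ℕ) (hPrefix h (t : ℕ) t.2.le)))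
          ≤ Est (T' : ℝ) δ'}).toReal ≥ 1 - δ'

/-- A packaged (decision space, observation space) pair. -/
structure MSpace where
  (X : Type)
  (Y : Type)
  [iX : MeasurableSpace X]
  [iY : MeasurableSpace Y]
  [nX : Nonempty X]

attribute [instance] MSpace.iX MSpace.iY MSpace.nX

end

/-- Removing a common part bounds the squared Hellinger distance by the remaining masses. -/
lemma sqHellinger_add_le {Z : Type} [MeasurableSpace Z] (R P Q : Measure Z)
    [IsFiniteMeasure R] [IsFiniteMeasure P] [IsFiniteMeasure Q] :
    sqHellinger (R + P) (R + Q) ≤ P.real Set.univ + Q.real Set.univ := by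
  unfold sqHellinger
  set ν := R + P + (R + Q) with hν
  have hP : P ≪ ν := by
    rw [hν, add_assoc, add_comm P, ← add_assoc]
    exact (Measure.le_add_left le_rfl).absolutelyContinuous
  have hQ : Q ≪ ν := by
    rw [hν, ← add_assoc]
    exact (Measure.le_add_left le_rfl).absolutelyContinuous
  calc _ ≤ ∫ z, ((P.rnDeriv ν z).toReal + (Q.rnDeriv ν z).toReal) ∂ν := by
        refine integral_mono_of_nonneg (.of_forall fun _ => sq_nonneg _)
          (Measure.integrable_toReal_rnDeriv.add Measure.integrable_toReal_rnDeriv) ?_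
        filter_upwards [Measure.rnDeriv_add R P ν, Measure.rnDeriv_add R Q ν,
          R.rnDeriv_lt_top ν, P.rnDeriv_lt_top ν, Q.rnDeriv_lt_top ν] with z h1 h2 h3 h4 h5
        simp only [Pi.add_apply] at h1 h2
        rw [h1, h2, ENNReal.toReal_add h3.ne h4.ne, ENNReal.toReal_add h3.ne h5.ne]
        set r := (R.rnDeriv ν z).toReal
        set a := (P.rnDeriv ν z).toReal
        set b := (Q.rnDeriv ν z).toReal
        have hr : 0 ≤ r := ENNReal.toReal_nonneg
        have ha : 0 ≤ a := ENNReal.toReal_nonneg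
        have hb : 0 ≤ b := ENNReal.toReal_nonneg
        have hra := Real.sq_sqrt (add_nonneg hr ha)
        have hrb := Real.sq_sqrt (add_nonneg hr hb)
        have h : r ≤ √(r + a) * √(r + b) := by
          rw [← Real.sqrt_mul (add_nonneg hr ha)]
          refine Real.le_sqrt_of_sq_le ?_
          nlinarith [mul_nonneg hr ha, mul_nonneg hr hb, mul_nonneg ha hb]
        nlinarith
    _ = P.real Set.univ + Q.real Set.univ := by
        rw [integral_add Measure.integrable_toReal_rnDeriv Measure.integrable_toReal_rnDeriv,
          Measure.integral_toReal_rnDeriv hP, Measure.integral_toReal_rnDeriv hQ]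

/-- The squared Hellinger distance dominates the mass `Q` puts on any `P`-null set. -/
lemma measureReal_le_sqHellinger {Z : Type} [MeasurableSpace Z] (P Q : Measure Z)
    [IsFiniteMeasure P] [IsFiniteMeasure Q] {A : Set Z} (hA : MeasurableSet A) (hPA : P A = 0) :
    Q.real A ≤ sqHellinger P Q := by
  unfold sqHellinger
  set ν := P + Q with hν
  have hP : P ≪ ν := (Measure.le_add_right le_rfl).absolutelyContinuous
  have hQ : Q ≪ ν := (Measure.le_add_left le_rfl).absolutelyContinuous
  have hzero : ∀ᵐ z ∂ν, z ∈ A → P.rnDeriv ν z = 0 := by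
    rw [← ae_restrict_iff' hA]
    refine (lintegral_eq_zero_iff (Measure.measurable_rnDeriv _ _)).1 ?_
    rw [Measure.setLIntegral_rnDeriv hP, hPA]
  rw [← Measure.setIntegral_toReal_rnDeriv hQ, ← integral_indicator hA]
  refine integral_mono_of_nonneg (.of_forall fun z => ?_) ?_ ?_
  · exact Set.indicator_nonneg (fun _ _ => ENNReal.toReal_nonneg) z
  · refine Integrable.mono' ((Measure.integrable_toReal_rnDeriv (μ := P) (ν := ν)).add
      (Measure.integrable_toReal_rnDeriv (μ := Q) (ν := ν))) ?_ (.of_forall fun z => ?_)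
    · exact Measurable.aestronglyMeasurable (by fun_prop)
    · have ha : 0 ≤ (P.rnDeriv ν z).toReal := ENNReal.toReal_nonneg
      have hb : 0 ≤ (Q.rnDeriv ν z).toReal := ENNReal.toReal_nonneg
      rw [Real.norm_of_nonneg (sq_nonneg _), Pi.add_apply]
      nlinarith [Real.sq_sqrt ha, Real.sq_sqrt hb, Real.sqrt_nonneg (P.rnDeriv ν z).toReal,
        Real.sqrt_nonneg (Q.rnDeriv ν z).toReal,
        mul_nonneg (Real.sqrt_nonneg (P.rnDeriv ν z).toReal)
          (Real.sqrt_nonneg (Q.rnDeriv ν z).toReal)]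
  · filter_upwards [hzero] with z hz
    by_cases hzA : z ∈ A
    · simp [hzA, hz hzA, Real.sq_sqrt]
    · simp only [hzA, not_false_eq_true, Set.indicator_of_notMem]
      exact sq_nonneg _

lemma sqHellinger_self {Z : Type} [MeasurableSpace Z] (P : Measure Z) : sqHellinger P P = 0 := by
  simp [sqHellinger]

section General

variable {U V : Type} [MeasurableSpace U] [MeasurableSpace V]

lemma Model.ae_reward_mem (M : Model U V) (x : U) :
    ∀ᵐ ry ∂(M.k x), ry.1 ∈ Set.Icc (0 : ℝ) 1 := M.reward01 x

lemma fm_nonneg (M : Model U V) (x : U) : 0 ≤ fm M x :=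
  integral_nonneg_of_ae ((M.ae_reward_mem x).mono fun _ h => h.1)

lemma fm_le_one (M : Model U V) (x : U) : fm M x ≤ 1 := by
  have := M.markov
  calc fm M x ≤ ∫ _, (1 : ℝ) ∂(M.k x) :=
        integral_mono_of_nonneg ((M.ae_reward_mem x).mono fun _ h => h.1) (integrable_const _)
          ((M.ae_reward_mem x).mono fun _ h => h.2)
    _ = 1 := by simp

lemma gap_nonneg (M : Model U V) (x : U) : 0 ≤ gap M x := sub_nonneg.2 (M.opt_max x)

lemma gap_le_one (M : Model U V) (x : U) : gap M x ≤ 1 := by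
  have h1 := fm_le_one M M.opt
  have h2 := fm_nonneg M x
  unfold gap
  linarith

lemma avgGap_nonneg (p : ProbabilityMeasure U) (M : Model U V) : 0 ≤ avgGap p M :=
  integral_nonneg (gap_nonneg M)

lemma avgGap_le_one (p : ProbabilityMeasure U) (M : Model U V) : avgGap p M ≤ 1 := by
  calc avgGap p M ≤ ∫ _, (1 : ℝ) ∂(p : Measure U) :=
        integral_mono_of_nonneg (.of_forall (gap_nonneg M)) (integrable_const _)
          (.of_forall (gap_le_one M))
    _ = 1 := by simp

lemma bddAbove_range_iSup_prop {ι : Type*} {f : ι → ℝ} {s : Set ι} {b : ℝ} (hb : 0 ≤ b)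
    (hf : ∀ i ∈ s, f i ≤ b) : BddAbove (Set.range fun i => ⨆ _ : i ∈ s, f i) := by
  refine ⟨b, ?_⟩
  rintro _ ⟨i, rfl⟩
  exact Real.iSup_le (hf i) hb

lemma le_biSup_real {ι : Type*} {f : ι → ℝ} {s : Set ι} {b : ℝ} (hb : 0 ≤ b)
    (hf : ∀ i ∈ s, f i ≤ b) {i : ι} (hi : i ∈ s) : f i ≤ ⨆ j ∈ s, f j :=
  le_ciSup_of_le (bddAbove_range_iSup_prop hb hf) i (by simp [hi])

lemma decC_le {ε b : ℝ} {𝓜 : Set (Model U V)} {Mbar : Model U V} (p : ProbabilityMeasure U)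
    (hb : 0 ≤ b) (h : ∀ M ∈ 𝓜, avgHell p M Mbar ≤ ε ^ 2 → avgGap p M ≤ b) :
    decC ε 𝓜 Mbar ≤ b := by
  refine ciInf_le_of_le ⟨0, ?_⟩ p (Real.iSup_le (fun M => Real.iSup_le (fun hM => ?_) hb) hb)
  · rintro _ ⟨q, rfl⟩
    exact Real.iSup_nonneg fun M => Real.iSup_nonneg fun _ => avgGap_nonneg q M
  · exact h M hM.1 hM.2

lemma le_decC [Nonempty U] {ε b : ℝ} {𝓜 : Set (Model U V)} {Mbar : Model U V}
    (h : ∀ p : ProbabilityMeasure U, ∃ M ∈ 𝓜, avgHell p M Mbar ≤ ε ^ 2 ∧ b ≤ avgGap p M) :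
    b ≤ decC ε 𝓜 Mbar := by
  have : Nonempty (ProbabilityMeasure U) :=
    ⟨⟨Measure.dirac (Classical.arbitrary U), inferInstance⟩⟩
  refine le_ciInf fun p => ?_
  obtain ⟨M, hM, hH, hb⟩ := h p
  exact hb.trans (le_biSup_real (f := avgGap p) (s := {M ∈ 𝓜 | avgHell p M Mbar ≤ ε ^ 2})
    zero_le_one (fun M _ => avgGap_le_one p M) ⟨hM, hH⟩)

lemma integrable_gap [Countable U] [MeasurableSingletonClass U] (p : ProbabilityMeasure U)
    (M : Model U V) : Integrable (gap M) (p : Measure U) :=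
  Integrable.of_bound (measurable_of_countable _).aestronglyMeasurable 1
    (.of_forall fun x => by
      rw [Real.norm_of_nonneg (gap_nonneg M x)]
      exact gap_le_one M x)

end General

/-- Laws of the hard instance `i`: decision `0` earns nothing but reveals `i` with
probability `t ^ 2`; decision `i + 1` earns `t` more than the other decisions. -/
noncomputable def hardLaw (t : ℝ) (i : ℕ) : ℕ → Measure (ℝ × ℕ)
  | 0 => ENNReal.ofReal (1 - t ^ 2) • Measure.dirac (0, 0)
      + ENNReal.ofReal (t ^ 2) • Measure.dirac (0, i + 1)
  | j + 1 => Measure.dirac (if i = j then 1 / 2 + t else 1 / 2, 0)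

section HardInstance

variable {t : ℝ}

lemma isProbabilityMeasure_hardLaw (ht : t ∈ Set.Icc (0 : ℝ) (1 / 2)) (i x : ℕ) :
    IsProbabilityMeasure (hardLaw t i x) := by
  cases x with
  | zero =>
    constructor
    have h : t ^ 2 ≤ 1 := by nlinarith [ht.1, ht.2]
    simp [hardLaw, ← ENNReal.ofReal_add (sub_nonneg.2 h) (sq_nonneg t)]
  | succ j => unfold hardLaw; infer_instance

lemma hardLaw_reward01 (ht : t ∈ Set.Icc (0 : ℝ) (1 / 2)) (i x : ℕ) :
    hardLaw t i x {ry : ℝ × ℕ | ry.1 ∈ Set.Icc (0 : ℝ) 1}ᶜ = 0 := by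
  have hm : MeasurableSet {ry : ℝ × ℕ | ry.1 ∈ Set.Icc (0 : ℝ) 1}ᶜ :=
    (measurable_fst measurableSet_Icc).compl
  cases x with
  | zero => simp [hardLaw]
  | succ j =>
    obtain ⟨h0, h1⟩ := ht
    rw [hardLaw, Measure.dirac_apply' _ hm]
    simp only [Set.indicator_apply_eq_zero, Set.mem_compl_iff, Set.mem_ofPred_eq, Set.mem_Icc]
    intro h
    refine absurd ?_ h
    split_ifs <;> constructor <;> linarith

/-- The mean rewards of the hard instance `i`. -/
noncomputable def hardMean (t : ℝ) (i : ℕ) : ℕ → ℝ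
  | 0 => 0
  | j + 1 => if i = j then 1 / 2 + t else 1 / 2

lemma integrable_fst_hardLaw (i x : ℕ) : Integrable (fun ry : ℝ × ℕ => ry.1) (hardLaw t i x) := by
  cases x with
  | zero =>
    exact ((integrable_dirac (by simp)).smul_measure ENNReal.ofReal_ne_top).add_measure
      ((integrable_dirac (by simp)).smul_measure ENNReal.ofReal_ne_top)
  | succ j => exact integrable_dirac (by simp)

lemma integral_fst_hardLaw (i x : ℕ) : ∫ ry, ry.1 ∂(hardLaw t i x) = hardMean t i x := by
  cases x with
  | zero =>
    rw [hardLaw, integral_add_measure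
      ((integrable_dirac (by simp)).smul_measure ENNReal.ofReal_ne_top)
      ((integrable_dirac (by simp)).smul_measure ENNReal.ofReal_ne_top)]
    simp [hardMean]
  | succ j => simp [hardLaw, hardMean]

lemma hardMean_le (ht : 0 ≤ t) (i x : ℕ) : hardMean t i x ≤ hardMean t i (i + 1) := by
  cases x with
  | zero => simp only [hardMean, if_true]; positivity
  | succ j => simp only [hardMean]; split_ifs <;> simp_all

/-- The hard instance `i` as a model. -/
noncomputable def hardModel (ht : t ∈ Set.Icc (0 : ℝ) (1 / 2)) (i : ℕ) : Model ℕ ℕ where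
  k := ⟨hardLaw t i, measurable_of_countable _⟩
  markov := ⟨isProbabilityMeasure_hardLaw ht i⟩
  reward01 := hardLaw_reward01 ht i
  opt := i + 1
  opt_max x := by
    simpa only [Kernel.coe_mk, integral_fst_hardLaw] using hardMean_le ht.1 i x

lemma hardModel_k (ht : t ∈ Set.Icc (0 : ℝ) (1 / 2)) (i x : ℕ) :
    (hardModel ht i).k x = hardLaw t i x := rfl

lemma fm_hardModel (ht : t ∈ Set.Icc (0 : ℝ) (1 / 2)) (i x : ℕ) :
    fm (hardModel ht i) x = hardMean t i x := integral_fst_hardLaw i x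

/-- The uniform mixture of the first `N` hard laws. -/
noncomputable def mixLaw (t : ℝ) (N : ℕ) (x : ℕ) : Measure (ℝ × ℕ) :=
  (N : ℝ≥0∞)⁻¹ • ∑ i ∈ Finset.range N, hardLaw t i x

lemma integral_fst_mixLaw (N x : ℕ) :
    ∫ ry, ry.1 ∂(mixLaw t N x) = (N : ℝ)⁻¹ * ∑ i ∈ Finset.range N, hardMean t i x := by
  rw [mixLaw, integral_smul_measure,
    integral_finsetSum_measure fun i _ => integrable_fst_hardLaw i x]
  simp [integral_fst_hardLaw]

lemma sum_hardMean_succ (N j : ℕ) :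
    ∑ i ∈ Finset.range N, hardMean t i (j + 1) = N * (1 / 2) + if j < N then t else 0 := by
  have h (i : ℕ) : hardMean t i (j + 1) = 1 / 2 + if i = j then t else 0 := by
    simp only [hardMean]; split_ifs <;> simp
  simp [h, Finset.sum_add_distrib]

/-- The uniform mixture of the first `N` hard instances as a model. -/
noncomputable def mixModel (ht : t ∈ Set.Icc (0 : ℝ) (1 / 2)) (N : ℕ) (hN : 0 < N) : Model ℕ ℕ where
  k := ⟨mixLaw t N, measurable_of_countable _⟩
  markov := by
    refine ⟨fun x => ⟨?_⟩⟩
    have := isProbabilityMeasure_hardLaw ht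
    simp only [Kernel.coe_mk, mixLaw, Measure.smul_apply, Measure.finsetSum_apply, measure_univ,
      Finset.sum_const, Finset.card_range, nsmul_eq_mul, mul_one, smul_eq_mul]
    exact ENNReal.inv_mul_cancel (by simpa using hN.ne') (by simp)
  reward01 x := by
    simp only [Kernel.coe_mk, mixLaw, Measure.smul_apply, Measure.finsetSum_apply,
      hardLaw_reward01 ht, Finset.sum_const_zero, smul_zero]
  opt := 1
  opt_max x := by
    simp only [Kernel.coe_mk, integral_fst_mixLaw]
    refine mul_le_mul_of_nonneg_left ?_ (by positivity)
    have h1 := sum_hardMean_succ (t := t) N 0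
    have := ht.1
    cases x with
    | zero =>
      rw [zero_add] at h1
      rw [h1]
      simp only [hardMean, Finset.sum_const_zero]
      positivity
    | succ j =>
      rw [zero_add] at h1
      rw [h1, sum_hardMean_succ]
      simp only [hN, if_true]
      split_ifs <;> linarith

lemma mixModel_mem_convHull (ht : t ∈ Set.Icc (0 : ℝ) (1 / 2)) (N : ℕ) (hN : 0 < N) :
    mixModel ht N hN ∈ convHull (Set.range (hardModel ht)) := by
  refine ⟨{ Ω := ℕ
            ν := (N : ℝ≥0∞)⁻¹ • ∑ i ∈ Finset.range N, Measure.dirac i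
            prob := ⟨?_⟩
            m := hardModel ht
            mem := fun i => ⟨i, rfl⟩
            meas := fun _ _ _ => measurable_of_countable _ }, fun x A hA => ?_⟩
  · simp only [Measure.smul_apply, Measure.finsetSum_apply, measure_univ,
      Finset.sum_const, Finset.card_range, nsmul_eq_mul, mul_one, smul_eq_mul]
    exact ENNReal.inv_mul_cancel (by simpa using hN.ne') (by simp)
  · simp [mixModel, mixLaw, hardModel_k, lintegral_smul_measure]

lemma sqHellinger_hardLaw_zero_mixLaw_le (N : ℕ) (hN : 0 < N) (i : ℕ) :
    sqHellinger (hardLaw t i 0) (mixLaw t N 0) ≤ 2 * t ^ 2 := by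
  have hN' : (N : ℝ≥0∞)⁻¹ * N = 1 := ENNReal.inv_mul_cancel (by simpa using hN.ne') (by simp)
  have hmix : mixLaw t N 0 = ENNReal.ofReal (1 - t ^ 2) • Measure.dirac (0, 0)
      + (N : ℝ≥0∞)⁻¹ • ∑ i ∈ Finset.range N,
        ENNReal.ofReal (t ^ 2) • Measure.dirac ((0 : ℝ), i + 1) := by
    simp only [mixLaw, hardLaw, Finset.sum_add_distrib, smul_add, Finset.sum_const,
      Finset.card_range]
    rw [← Nat.cast_smul_eq_nsmul ℝ≥0∞, smul_smul, hN', one_smul]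
  have hfin : ((N : ℝ≥0∞)⁻¹ • ∑ i ∈ Finset.range N,
      ENNReal.ofReal (t ^ 2) • Measure.dirac ((0 : ℝ), i + 1)) Set.univ
        = ENNReal.ofReal (t ^ 2) := by
    simp [← mul_assoc, hN']
  have : IsFiniteMeasure ((N : ℝ≥0∞)⁻¹ • ∑ i ∈ Finset.range N,
      ENNReal.ofReal (t ^ 2) • Measure.dirac ((0 : ℝ), i + 1)) := ⟨by simp [hfin]⟩
  have := (Measure.dirac ((0 : ℝ), 0)).smul_finite (c := ENNReal.ofReal (1 - t ^ 2))
    ENNReal.ofReal_ne_top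
  have := (Measure.dirac ((0 : ℝ), i + 1)).smul_finite (c := ENNReal.ofReal (t ^ 2))
    ENNReal.ofReal_ne_top
  rw [hmix, hardLaw]
  refine (sqHellinger_add_le _ _ _).trans ?_
  simp only [Measure.real, hfin, Measure.smul_apply, measure_univ, smul_eq_mul, mul_one]
  rw [ENNReal.toReal_ofReal (sq_nonneg t)]
  linarith

lemma sqHellinger_hardLaw_succ_mixLaw_le (N : ℕ) (hN : 0 < N) {i j : ℕ} (hij : i ≠ j) :
    sqHellinger (hardLaw t i (j + 1)) (mixLaw t N (j + 1)) ≤ 2 / N := by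
  have hN' : (N : ℝ≥0∞)⁻¹ * N = 1 := ENNReal.inv_mul_cancel (by simpa using hN.ne') (by simp)
  have hNtop : (N : ℝ≥0∞)⁻¹ ≠ ⊤ := by simpa using hN.ne'
  let far := (Finset.range N).filter fun k => ¬ k = j
  let near := (Finset.range N).filter fun k => k = j
  let δ : Measure (ℝ × ℕ) := Measure.dirac (1 / 2, 0)
  let δ' : Measure (ℝ × ℕ) := Measure.dirac (1 / 2 + t, 0)
  have hmix : mixLaw t N (j + 1) = (N : ℝ≥0∞)⁻¹ • ∑ k ∈ far, δ + (N : ℝ≥0∞)⁻¹ • ∑ k ∈ near, δ' := by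
    rw [mixLaw, ← Finset.sum_filter_not_add_sum_filter (Finset.range N) (fun k => k = j), smul_add]
    congr 2
    · refine Finset.sum_congr rfl fun k hk => ?_
      simp [hardLaw, (Finset.mem_filter.1 hk).2, δ]
    · refine Finset.sum_congr rfl fun k hk => ?_
      simp [hardLaw, (Finset.mem_filter.1 hk).2, δ']
  have hhard : hardLaw t i (j + 1)
      = (N : ℝ≥0∞)⁻¹ • ∑ k ∈ far, δ + (N : ℝ≥0∞)⁻¹ • ∑ k ∈ near, δ := by
    rw [← smul_add, Finset.sum_filter_not_add_sum_filter, Finset.sum_const, Finset.card_range,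
      ← Nat.cast_smul_eq_nsmul ℝ≥0∞, smul_smul, hN', one_smul]
    simp [hardLaw, hij, δ]
  have hcard : (near.card : ℝ) ≤ 1 := by
    exact_mod_cast Finset.card_le_one.2 fun a ha b hb =>
      by
        rw [(Finset.mem_filter.1 ha).2, (Finset.mem_filter.1 hb).2]
  have hfin (s : Finset ℕ) (μ : Measure (ℝ × ℕ)) [IsProbabilityMeasure μ] :
      IsFiniteMeasure ((N : ℝ≥0∞)⁻¹ • ∑ k ∈ s, μ) := Measure.smul_finite _ hNtop
  have hreal (μ : Measure (ℝ × ℕ)) [IsProbabilityMeasure μ] :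
      ((N : ℝ≥0∞)⁻¹ • ∑ k ∈ near, μ).real Set.univ ≤ 1 / N := by
    simp only [Measure.real, Measure.smul_apply, measure_univ,
      Finset.sum_const, nsmul_eq_mul, mul_one, smul_eq_mul, ENNReal.toReal_mul,
      ENNReal.toReal_inv, ENNReal.toReal_natCast]
    rw [one_div]
    exact mul_le_of_le_one_right (by positivity) hcard
  have := hfin far δ
  have := hfin near δ
  have := hfin near δ'
  rw [hmix, hhard]
  refine (sqHellinger_add_le _ _ _).trans ?_
  have h1 := hreal δ
  have h2 := hreal δ'
  have h3 : (2 : ℝ) / N = 1 / N + 1 / N := by ring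
  linarith

lemma sqHellinger_le_two {Z : Type} [MeasurableSpace Z] (P Q : Measure Z)
    [IsProbabilityMeasure P] [IsProbabilityMeasure Q] : sqHellinger P Q ≤ 2 := by
  have h := sqHellinger_add_le 0 P Q
  simp only [zero_add, probReal_univ] at h
  linarith

lemma sqHellinger_nonneg {Z : Type} [MeasurableSpace Z] (P Q : Measure Z) :
    0 ≤ sqHellinger P Q := integral_nonneg fun _ => sq_nonneg _

lemma avgHell_hardModel_mixModel_le (ht : t ∈ Set.Icc (0 : ℝ) (1 / 2)) (N : ℕ) (hN : 0 < N)
    (i : ℕ) (p : ProbabilityMeasure ℕ) :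
    avgHell p (hardModel ht i) (mixModel ht N hN)
      ≤ 2 * t ^ 2 * (p : Measure ℕ).real {0} + 2 * (p : Measure ℕ).real {i + 1} + 2 / N := by
  have hint (a : ℝ) (x : ℕ) :
      Integrable (({x} : Set ℕ).indicator fun _ => a) (p : Measure ℕ) :=
    (integrable_const a).indicator (measurableSet_singleton x)
  calc avgHell p (hardModel ht i) (mixModel ht N hN)
      ≤ ∫ x, (({0} : Set ℕ).indicator (fun _ => 2 * t ^ 2) x
          + ({i + 1} : Set ℕ).indicator (fun _ => (2 : ℝ)) x + 2 / N) ∂(p : Measure ℕ) := by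
        refine integral_mono_of_nonneg (.of_forall fun _ => sqHellinger_nonneg _ _)
          (((hint _ _).add (hint _ _)).add (integrable_const _)) (.of_forall fun x => ?_)
        have hNn : (0 : ℝ) ≤ 2 / N := by positivity
        rcases x with _ | j
        · have := sqHellinger_hardLaw_zero_mixLaw_le (t := t) N hN i
          simp only [hardModel_k]
          change sqHellinger (hardLaw t i 0) (mixLaw t N 0) ≤ _
          simp
          linarith
        · by_cases hij : i = j
          · subst hij
            have := (hardModel ht i).markov
            have := (mixModel ht N hN).markov
            have := sqHellinger_le_two ((hardModel ht i).k (i + 1)) ((mixModel ht N hN).k (i + 1))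
            simp
            linarith
          · have := sqHellinger_hardLaw_succ_mixLaw_le (t := t) N hN hij
            change sqHellinger (hardLaw t i (j + 1)) (mixLaw t N (j + 1)) ≤ _
            simpa [Ne.symm hij] using this
    _ = _ := by
        have h := integral_add ((hint (2 * t ^ 2) 0).add (hint 2 (i + 1)))
          (integrable_const (2 / N : ℝ))
        simp only [Pi.add_apply] at h
        rw [h, integral_add (hint _ _) (hint _ _),
          integral_indicator_const _ (measurableSet_singleton _),
          integral_indicator_const _ (measurableSet_singleton _)]
        simp only [smul_eq_mul, integral_const, probReal_univ]
        ring

lemma le_avgGap_mixModel (ht : t ∈ Set.Icc (0 : ℝ) (1 / 2)) (N : ℕ) (hN : 0 < N)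
    (p : ProbabilityMeasure ℕ) :
    (p : Measure ℕ).real {0} / 2 ≤ avgGap p (mixModel ht N hN) := by
  calc (p : Measure ℕ).real {0} / 2
      = ∫ x, ({0} : Set ℕ).indicator (fun _ => (1 / 2 : ℝ)) x ∂(p : Measure ℕ) := by
        rw [integral_indicator_const _ (measurableSet_singleton 0), smul_eq_mul]
        ring
    _ ≤ avgGap p (mixModel ht N hN) := by
        refine integral_mono ((integrable_const _).indicator (measurableSet_singleton 0))
          (integrable_gap p _) fun x => Set.indicator_le' (fun y hy => ?_)
            (fun y _ => gap_nonneg _ y) x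
        rw [Set.mem_singleton_iff.1 hy]
        change _ ≤ (∫ ry, ry.1 ∂(mixLaw t N (0 + 1))) - ∫ ry, ry.1 ∂(mixLaw t N 0)
        rw [integral_fst_mixLaw, integral_fst_mixLaw, sum_hardMean_succ]
        have hN' : (0 : ℝ) < N := by exact_mod_cast hN
        simp only [hN, if_true, hardMean, Finset.sum_const_zero, mul_zero, sub_zero]
        rw [mul_add, ← mul_assoc, inv_mul_cancel₀ hN'.ne', one_mul]
        have := ht.1
        have : 0 ≤ (N : ℝ)⁻¹ * t := by positivity
        linarith

lemma le_avgGap_hardModel (ht : t ∈ Set.Icc (0 : ℝ) (1 / 2)) (i : ℕ) (p : ProbabilityMeasure ℕ) :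
    t * (1 - (p : Measure ℕ).real {i + 1}) ≤ avgGap p (hardModel ht i) := by
  calc t * (1 - (p : Measure ℕ).real {i + 1})
      = ∫ x, ({i + 1} : Set ℕ)ᶜ.indicator (fun _ => t) x ∂(p : Measure ℕ) := by
        rw [integral_indicator_const _ (measurableSet_singleton _).compl, smul_eq_mul,
          probReal_compl_eq_one_sub (measurableSet_singleton _)]
        ring
    _ ≤ avgGap p (hardModel ht i) := by
        refine integral_mono ((integrable_const _).indicator (measurableSet_singleton _).compl)
          (integrable_gap p _) fun x => Set.indicator_le' (fun y hy => ?_)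
            (fun y _ => gap_nonneg _ y) x
        change _ ≤ fm _ (i + 1) - fm _ y
        rw [fm_hardModel, fm_hardModel]
        obtain ⟨h0, h1⟩ := ht
        rcases y with _ | j
        · simp only [hardMean, if_true]
          linarith
        · have : i ≠ j := fun h => hy (by simp [h])
          simp [hardMean, this]

lemma exists_small_atom (p : ProbabilityMeasure ℕ) (N : ℕ) (hN : 0 < N) :
    ∃ i, (p : Measure ℕ).real {i + 1} ≤ 1 / N := by
  by_contra! h
  have hN' : (0 : ℝ) < N := by exact_mod_cast hN
  have hs : ∑ i ∈ Finset.range N, (1 / N : ℝ) <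
      ∑ i ∈ Finset.range N, (p : Measure ℕ).real {i + 1} :=
    Finset.sum_lt_sum_of_nonempty (by simpa using hN.ne') fun i _ => h i
  have hle : ∑ y ∈ (Finset.range N).map (addRightEmbedding 1), (p : Measure ℕ).real {y} ≤ 1 := by
    rw [sum_measureReal_singleton]
    exact measureReal_le_one
  rw [Finset.sum_map] at hle
  simp only [addRightEmbedding_apply] at hle
  simp only [Finset.sum_const, Finset.card_range, nsmul_eq_mul] at hs
  rw [mul_one_div_cancel hN'.ne'] at hs
  linarith

lemma le_decC_union_mixModel (ht : t ∈ Set.Icc (0 : ℝ) (1 / 2)) (N : ℕ) (hN : 2 ≤ N)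
    {ε : ℝ} (hε : ε ^ 2 = t ^ 3) (hNt : 8 / t ^ 3 ≤ N) (ht0 : 0 < t) :
    t / 8 ≤ decC ε (Set.range (hardModel ht) ∪ {mixModel ht N (by lia)})
      (mixModel ht N (by lia)) := by
  have hN0 : 0 < N := by lia
  have hN' : (2 : ℝ) ≤ N := by exact_mod_cast hN
  refine le_decC fun p => ?_
  rcases le_total (t / 4) ((p : Measure ℕ).real {0}) with hq | hq
  · refine ⟨_, Or.inr rfl, ?_, ?_⟩
    · simp only [avgHell, sqHellinger_self, integral_zero]
      positivity
    · exact le_trans (by linarith) (le_avgGap_mixModel ht N hN0 p)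
  · obtain ⟨i, hi⟩ := exists_small_atom p N hN0
    refine ⟨hardModel ht i, Or.inl ⟨i, rfl⟩, ?_, ?_⟩
    · refine (avgHell_hardModel_mixModel_le ht N hN0 i p).trans ?_
      have h1 : 2 * t ^ 2 * (p : Measure ℕ).real {0} ≤ 2 * t ^ 2 * (t / 4) := by gcongr
      have h2 : (1 : ℝ) / N ≤ t ^ 3 / 8 := by
        rw [div_le_iff₀ (by positivity)] at hNt
        rw [div_le_div_iff₀ (by positivity) (by positivity)]
        linarith
      have h3 : (2 : ℝ) / N = 1 / N + 1 / N := by ring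
      rw [hε]
      nlinarith
    · refine le_trans ?_ (le_avgGap_hardModel ht i p)
      have h2 : (1 : ℝ) / N ≤ 1 / 2 := one_div_le_one_div_of_le (by norm_num) hN'
      nlinarith

/-- Either decision `i + 1` earns its bonus, or decision `0` reveals an instance other than `i`. -/
lemma hardLaw_reveal_add (ht : 0 < t) (i k : ℕ) :
    ENNReal.ofReal (t ^ 2) * hardLaw t k (i + 1) {(1 / 2 + t, 0)}
      + hardLaw t k 0 {ry | ry.2 ≠ 0 ∧ ry.2 ≠ i + 1} = ENNReal.ofReal (t ^ 2) := by
  have hm : MeasurableSet {ry : ℝ × ℕ | ry.2 ≠ 0 ∧ ry.2 ≠ i + 1} :=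
    measurable_snd (MeasurableSet.of_discrete (s := {y : ℕ | y ≠ 0 ∧ y ≠ i + 1}))
  by_cases h : k = i <;>
    simp [hardLaw, Measure.dirac_apply' _ hm, h, ht.ne']

lemma avgHell_dirac (x : ℕ) (M Mbar : Model ℕ ℕ) :
    avgHell ⟨Measure.dirac x, inferInstance⟩ M Mbar = sqHellinger (M.k x) (Mbar.k x) := by
  simp [avgHell]

lemma avgGap_dirac (x : ℕ) (M : Model ℕ ℕ) :
    avgGap ⟨Measure.dirac x, inferInstance⟩ M = gap M x := by
  simp [avgGap]

lemma decC_hardModel_le_zero (ht : t ∈ Set.Icc (0 : ℝ) (1 / 2)) (ht0 : 0 < t) (ht1 : t < 1 / 2)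
    {ε : ℝ} (hε : ε ^ 2 = t ^ 3) {Mbar : Model ℕ ℕ}
    (hM : Mbar ∈ convHull (Set.range (hardModel ht))) :
    decC ε (Set.range (hardModel ht)) Mbar ≤ 0 := by
  obtain ⟨D, hD⟩ := hM
  have := D.prob
  have := Mbar.markov
  have hmarkov := fun i => (hardModel ht i).markov
  let A : ℝ × ℕ := (1 / 2 + t, 0)
  let B (i : ℕ) : Set (ℝ × ℕ) := {ry | ry.2 ≠ 0 ∧ ry.2 ≠ i + 1}
  have hB (i : ℕ) : MeasurableSet (B i) :=
    measurable_snd (MeasurableSet.of_discrete (s := {y : ℕ | y ≠ 0 ∧ y ≠ i + 1}))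
  have hsum (i : ℕ) : t ^ 2 * (Mbar.k (i + 1)).real {A} + (Mbar.k 0).real (B i) = t ^ 2 := by
    have h : ENNReal.ofReal (t ^ 2) * Mbar.k (i + 1) {A} + Mbar.k 0 (B i)
        = ENNReal.ofReal (t ^ 2) := by
      rw [hD _ _ (measurableSet_singleton A), hD _ _ (hB i),
        ← lintegral_const_mul _ (D.meas _ _ (measurableSet_singleton A)),
        ← lintegral_add_right _ (D.meas _ _ (hB i))]
      calc _ = ∫⁻ _, ENNReal.ofReal (t ^ 2) ∂D.ν := by
            refine lintegral_congr fun ω => ?_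
            obtain ⟨k, hk⟩ := D.mem ω
            rw [← hk]
            exact hardLaw_reveal_add ht0 i k
        _ = _ := by simp
    have h' := congrArg ENNReal.toReal h
    rwa [ENNReal.toReal_add (ENNReal.mul_ne_top ENNReal.ofReal_ne_top (measure_ne_top _ _))
      (measure_ne_top _ _), ENNReal.toReal_mul, ENNReal.toReal_ofReal (sq_nonneg t)] at h'
  by_cases hw : ∃ i, 1 / 2 < (Mbar.k (i + 1)).real {A}
  · obtain ⟨i, hi⟩ := hw
    refine decC_le ⟨Measure.dirac (i + 1), inferInstance⟩ le_rfl ?_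
    rintro _ ⟨k, rfl⟩ hH
    rw [avgHell_dirac] at hH
    rw [avgGap_dirac]
    by_cases hk : k = i
    · subst hk
      exact (sub_self _).le
    · have hnull : (hardModel ht k).k (i + 1) {A} = 0 := by
        simp [hardModel_k, hardLaw, hk, A, ht0.ne']
      have := measureReal_le_sqHellinger _ (Mbar.k (i + 1)) (measurableSet_singleton A) hnull
      have : t ^ 3 ≤ 1 / 2 := by nlinarith [pow_le_one₀ (n := 2) ht0.le (by linarith)]
      linarith
  · push Not at hw
    refine decC_le ⟨Measure.dirac 0, inferInstance⟩ le_rfl ?_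
    rintro _ ⟨k, rfl⟩ hH
    rw [avgHell_dirac] at hH
    have hnull : (hardModel ht k).k 0 (B k) = 0 := by
      simp [hardModel_k, hardLaw, Measure.dirac_apply' _ (hB k), B]
    have h1 := measureReal_le_sqHellinger _ (Mbar.k 0) (hB k) hnull
    have h2 := hsum k
    have h3 := mul_le_mul_of_nonneg_left (hw k) (sq_nonneg t)
    have h4 : t ^ 3 < t ^ 2 * (1 / 2) := by
      rw [pow_succ]
      gcongr
    linarith

end HardInstance

/-- suboptimality under the reference model is essential for regret. -/
theorem regret_union_counterexample :
    ∃ c c' ε₀ : ℝ, 0 < c ∧ 0 < c' ∧ 0 < ε₀ ∧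
      ∀ ε : ℝ, 0 < ε → ε < ε₀ →
        ∃ (S : MSpace) (𝓜 : Set (Model S.X S.Y)),
          (⨆ Mbar ∈ convHull 𝓜, decC ε 𝓜 Mbar) ≤ c * ε ∧
          c' * ε ^ ((2 : ℝ) / 3) ≤ ⨆ Mbar ∈ convHull 𝓜, decC ε (𝓜 ∪ {Mbar}) Mbar := by
  refine ⟨1, 1 / 8, 1 / 8, one_pos, by norm_num, by norm_num, fun ε hε0 hε1 => ?_⟩
  set t : ℝ := ε ^ ((2 : ℝ) / 3) with ht_def
  have ht0 : 0 < t := Real.rpow_pos_of_pos hε0 _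
  have hε : ε ^ 2 = t ^ 3 := by
    rw [ht_def, ← Real.rpow_mul_natCast hε0.le, ← Real.rpow_natCast]
    norm_num
  have ht1 : t < 1 / 2 := by
    refine lt_of_pow_lt_pow_left₀ 3 (by norm_num) ?_
    rw [← hε]
    nlinarith
  have ht : t ∈ Set.Icc (0 : ℝ) (1 / 2) := ⟨ht0.le, ht1.le⟩
  refine ⟨{ X := ℕ, Y := ℕ }, Set.range (hardModel ht), ?_, ?_⟩
  · rw [one_mul]
    exact Real.iSup_le (fun Mbar => Real.iSup_le
      (fun hM => (decC_hardModel_le_zero ht ht0 ht1 hε hM).trans hε0.le) hε0.le) hε0.le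
  · obtain ⟨N, hN⟩ := exists_nat_ge (max 2 (8 / t ^ 3))
    have hN2 : 2 ≤ N := by exact_mod_cast (le_max_left _ _).trans hN
    refine le_trans ?_ (le_biSup_real
      (f := fun Mbar => decC ε (Set.range (hardModel ht) ∪ {Mbar}) Mbar) zero_le_one
      (fun Mbar _ => decC_le ⟨Measure.dirac 0, inferInstance⟩ zero_le_one
        fun M _ _ => avgGap_le_one _ M)
      (mixModel_mem_convHull ht N (by lia)))
    refine le_trans (by linarith) (le_decC_union_mixModel ht N hN2 hε
      ((le_max_right _ _).trans hN) ht0)
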